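/- Let K₁ ∈ ℝ satisfy ‖∇_{(x,a)}h(q,x,a)‖ ≤ K₁ for all (q,x,a) ∈ Ω. Then J is K₁-Lipschitz on Δ × I, and J is ((1−q₀−ε)λ_M)-strongly convex on Δ × I, i.e. the function (x,a) ↦ J(x,a) − ((1−q₀−ε)λ_M/2)·‖(x,a)‖² is convex on Δ × I. -/

import Mathlib

open Matrix

noncomputable section

/-- `ℝ^d` with the Euclidean inner product and norm. -/
abbrev E (d : ℕ) := EuclideanSpace ℝ (Fin d)

/-- `ℝ^d × ℝ` equipped with the Euclidean (`L²`) product norm. -/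
abbrev Pair (d : ℕ) := WithLp 2 (E d × ℝ)

/-- the standard simplex `Δ`. -/
def simplexSet (d : ℕ) : Set (E d) := {x | (∀ i, 0 ≤ x i) ∧ ∑ i, x i = 1}

/-- `S(x,a) = sqrt(xᵀΣ_S x + (xᵀμ_S − (2a+γ)/2)²)`. -/
def Sfn (d : ℕ) (SigS : Matrix (Fin d) (Fin d) ℝ) (μS : E d) (γ : ℝ)
    (x : E d) (a : ℝ) : ℝ :=
  Real.sqrt (x ⬝ᵥ SigS.mulVec x + (x ⬝ᵥ μS - (2 * a + γ) / 2) ^ 2)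

/-- `V(q,x,a) = (r(q)‖x‖ + S(x,a))² − aγ − γ²/4`. -/
def Vfn (d : ℕ) (SigS : Matrix (Fin d) (Fin d) ℝ) (μS : E d) (γ : ℝ) (r : ℝ → ℝ)
    (q : ℝ) (x : E d) (a : ℝ) : ℝ :=
  (r q * ‖x‖ + Sfn d SigS μS γ x a) ^ 2 - a * γ - γ ^ 2 / 4

/-- `e_N(x,a) = xᵀΣ_N x + (xᵀμ_N − a)² − γ·xᵀμ_N`. -/
def eNfn (d : ℕ) (SigN : Matrix (Fin d) (Fin d) ℝ) (μN : E d) (γ : ℝ)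
    (x : E d) (a : ℝ) : ℝ :=
  x ⬝ᵥ SigN.mulVec x + (x ⬝ᵥ μN - a) ^ 2 - γ * (x ⬝ᵥ μN)

/-- `h(q,x,a) = (1−q)·e_N(x,a) + q·V(q,x,a)`. -/
def hfn (d : ℕ) (SigN SigS : Matrix (Fin d) (Fin d) ℝ) (μN μS : E d) (γ : ℝ) (r : ℝ → ℝ)
    (q : ℝ) (x : E d) (a : ℝ) : ℝ :=
  (1 - q) * eNfn d SigN μN γ x a + q * Vfn d SigS μS γ r q x a

/-- `J(x,a) = max_{q ∈ [q₀−ε, q₀+ε]} h(q,x,a)`. -/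
def Jfn (d : ℕ) (SigN SigS : Matrix (Fin d) (Fin d) ℝ) (μN μS : E d) (γ : ℝ) (r : ℝ → ℝ)
    (q₀ ε : ℝ) (x : E d) (a : ℝ) : ℝ :=
  sSup ((fun q => hfn d SigN SigS μN μS γ r q x a) '' Set.Icc (q₀ - ε) (q₀ + ε))

/-- the pair `(x,a)` as an element of the `L²` product space. -/
def mkPair (d : ℕ) (x : E d) (a : ℝ) : Pair d := (WithLp.equiv 2 (E d × ℝ)).symm (x, a)

/-- gradient `∇_{(x,a)} h(q,·,·)` in the joint variable `(x,a)`. -/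
def gradh (d : ℕ) (SigN SigS : Matrix (Fin d) (Fin d) ℝ) (μN μS : E d) (γ : ℝ) (r : ℝ → ℝ)
    (q : ℝ) (pt : Pair d) : Pair d :=
  gradient (fun y : Pair d =>
    hfn d SigN SigS μN μS γ r q (WithLp.equiv 2 (E d × ℝ) y).1
      (WithLp.equiv 2 (E d × ℝ) y).2) pt

/-- `lam` is the smallest eigenvalue of the symmetric matrix `M`, characterized as the
largest constant `t` with `zᵀMz ≥ t‖z‖²` for all `z` (Rayleigh quotient). -/
def IsSmallestEigen {n : Type*} [Fintype n] (M : Matrix n n ℝ) (lam : ℝ) : Prop :=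
  IsGreatest {t : ℝ | ∀ z : n → ℝ, t * (z ⬝ᵥ z) ≤ z ⬝ᵥ M.mulVec z} lam

/-- the `(d+1)×(d+1)` block matrix `M = [[Σ_N + μ_N μ_Nᵀ, −μ_N], [−μ_Nᵀ, 1]]`. -/
def Mblock (d : ℕ) (SigN : Matrix (Fin d) (Fin d) ℝ) (μN : E d) :
    Matrix (Fin d ⊕ Unit) (Fin d ⊕ Unit) ℝ :=
  Matrix.fromBlocks (SigN + vecMulVec μN μN) (fun i (_ : Unit) => -μN i)
    (fun (_ : Unit) j => -μN j) 1


theorem eN_key (d : ℕ) (SigN : Matrix (Fin d) (Fin d) ℝ) (μN : E d) (lamM : ℝ)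
    (h : IsSmallestEigen (Mblock d SigN μN) lamM) (x : E d) (a : ℝ) :
    lamM * (‖x‖ ^ 2 + a ^ 2) ≤ x ⬝ᵥ SigN.mulVec x + (x ⬝ᵥ μN - a) ^ 2 := by
  have h1 := h.1 (Sum.elim (fun i => x i) (fun _ => a))
  have e1 : (Sum.elim (fun i => x i) (fun _ => a) : Fin d ⊕ Unit → ℝ) ⬝ᵥ
      Sum.elim (fun i => x i) (fun _ => a) = ‖x‖ ^ 2 + a ^ 2 := by
    rw [EuclideanSpace.real_norm_sq_eq]
    simp [dotProduct, pow_two]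
  have e2 : (Sum.elim (fun i => x i) (fun _ => a) : Fin d ⊕ Unit → ℝ) ⬝ᵥ
      (Mblock d SigN μN).mulVec (Sum.elim (fun i => x i) (fun _ => a))
      = x ⬝ᵥ SigN.mulVec x + (x ⬝ᵥ μN - a) ^ 2 := by
    have a1 : (fun i (_ : Unit) => -μN i : Matrix (Fin d) Unit ℝ) *ᵥ (fun _ => a)
        = (-a) • (μN : Fin d → ℝ) := by
      ext i; simp [mulVec, dotProduct]; ring
    have a2 : (fun (_ : Unit) j => -μN j : Matrix Unit (Fin d) ℝ) *ᵥ (fun i => x i)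
        = fun _ => -(x ⬝ᵥ μN) := by
      ext i; simp [mulVec, dotProduct, mul_comm]
    refine (congrArg _ (fromBlocks_mulVec (SigN + vecMulVec μN μN)
      (fun i (_ : Unit) => -μN i : Matrix (Fin d) Unit ℝ)
      (fun (_ : Unit) j => -μN j : Matrix Unit (Fin d) ℝ) 1 _)).trans ?_
    rw [sumElim_dotProduct_sumElim]
    simp only [Sum.elim_comp_inl, Sum.elim_comp_inr]
    rw [a1, a2, add_mulVec, dotProduct_add, dotProduct_add, vecMulVec_mulVec, dotProduct_smul]
    simp only [one_mulVec, dotProduct_add]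
    have : (μN : Fin d → ℝ) ⬝ᵥ (fun i => x i) = x ⬝ᵥ μN := dotProduct_comm _ _
    simp only [this]
    have hsum : ∑ i, x i * (a * μN i) = a * ∑ i, x i * μN i := by
      rw [Finset.mul_sum]
      exact Finset.sum_congr rfl fun i _ => by ring
    simp [dotProduct, hsum]
    ring
  rw [e1, e2] at h1
  exact h1

theorem eN_conv (d : ℕ) (SigN : Matrix (Fin d) (Fin d) ℝ) (μN : E d) (γ lamM : ℝ)
    (h : IsSmallestEigen (Mblock d SigN μN) lamM) :
    ConvexOn ℝ Set.univ (fun p : E d × ℝ =>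
      eNfn d SigN μN γ p.1 p.2 - lamM * (‖p.1‖ ^ 2 + p.2 ^ 2)) := by
  refine ⟨convex_univ, ?_⟩
  rintro ⟨x, a⟩ - ⟨y, b⟩ - s t hs ht hst
  have k := eN_key d SigN μN lamM h (x - y) (a - b)
  have n1 : ‖s • x + t • y‖ ^ 2 = s ^ 2 * ‖x‖ ^ 2 + 2 * s * t * inner ℝ x y + t ^ 2 * ‖y‖ ^ 2 := by
    rw [norm_add_sq_real, norm_smul, norm_smul, inner_smul_left, inner_smul_right, mul_pow, mul_pow]
    simp; ring
  rw [norm_sub_sq_real] at k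
  have hst0 : 0 ≤ s * t := mul_nonneg hs ht
  have k2 := mul_le_mul_of_nonneg_left k hst0
  simp only [eNfn, Prod.smul_fst, Prod.smul_snd, Prod.fst_add, Prod.snd_add, n1, smul_eq_mul]
  simp only [WithLp.ofLp_add, WithLp.ofLp_smul, WithLp.ofLp_sub, mulVec_add, mulVec_sub, mulVec_smul,
    dotProduct_add, add_dotProduct, sub_dotProduct, dotProduct_sub, smul_dotProduct,
    dotProduct_smul, smul_eq_mul] at k2 ⊢
  have ht' : t = 1 - s := by linarith
  subst ht'
  linarith

open scoped MatrixOrder Matrix.Norms.L2Operator in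
theorem psd_factor {d : ℕ} {A : Matrix (Fin d) (Fin d) ℝ} (h : A.PosSemidef) :
    ∃ B : Matrix (Fin d) (Fin d) ℝ, A = Bᴴ * B :=
  CStarAlgebra.nonneg_iff_eq_star_mul_self.1 h.nonneg

theorem S_conv (d : ℕ) (SigS : Matrix (Fin d) (Fin d) ℝ) (μS : E d) (γ : ℝ)
    (hPDS : SigS.PosDef) :
    ConvexOn ℝ Set.univ (fun p : E d × ℝ => Sfn d SigS μS γ p.1 p.2) := by
  obtain ⟨B, hB⟩ := psd_factor hPDS.posSemidef
  have e : ∀ p : E d × ℝ, Sfn d SigS μS γ p.1 p.2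
      = ‖(WithLp.toLp 2 ((WithLp.toLp 2 (B.mulVec p.1) : E d),
          (p.1 ⬝ᵥ μS - (2 * p.2 + γ) / 2)) : Pair d)‖ := by
    intro p
    rw [WithLp.prod_norm_eq_of_L2, Sfn]
    congr 1
    simp only [EuclideanSpace.real_norm_sq_eq, Real.norm_eq_abs, sq_abs]
    rw [hB, ← mulVec_mulVec, dotProduct_mulVec, conjTranspose_eq_transpose_of_trivial,
      vecMul_transpose]
    simp [dotProduct, pow_two]
  refine ⟨convex_univ, ?_⟩
  rintro p - p' - s t hs ht hst
  set F : E d × ℝ → Pair d := fun p => WithLp.toLp 2 ((WithLp.toLp 2 (B.mulVec p.1) : E d),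
          (p.1 ⬝ᵥ μS - (2 * p.2 + γ) / 2)) with hF
  have e' : ∀ p : E d × ℝ, Sfn d SigS μS γ p.1 p.2 = ‖F p‖ := e
  simp only [e']
  have key : F (s • p + t • p') = s • F p + t • F p' := by
    simp only [hF]
    rw [← WithLp.toLp_smul, ← WithLp.toLp_smul, ← WithLp.toLp_add]
    congr 1
    ext i
    · simp [mulVec_add, mulVec_smul]
    · simp
      have ht' : t = 1 - s := by linarith
      subst ht'
      ring
  rw [key]
  refine (norm_add_le _ _).trans (le_of_eq ?_)
  rw [norm_smul, norm_smul, Real.norm_of_nonneg hs, Real.norm_of_nonneg ht]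
  rfl

theorem V_conv (d : ℕ) (SigS : Matrix (Fin d) (Fin d) ℝ) (μS : E d) (γ : ℝ)
    (hPDS : SigS.PosDef) (r : ℝ → ℝ) (hrpos : ∀ q, 0 ≤ r q) (q : ℝ) :
    ConvexOn ℝ Set.univ (fun p : E d × ℝ => Vfn d SigS μS γ r q p.1 p.2) := by
  have h1 : ConvexOn ℝ Set.univ (fun p : E d × ℝ => ‖p.1‖) :=
    (convexOn_norm convex_univ).comp_linearMap (LinearMap.fst ℝ (E d) ℝ)
  have h2 := ((h1.smul (hrpos q)).add (S_conv d SigS μS γ hPDS)).pow (fun p _ => by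
    simp only [Pi.add_apply, smul_eq_mul, Pi.smul_apply]
    have := hrpos q
    have : 0 ≤ Sfn d SigS μS γ p.1 p.2 := Real.sqrt_nonneg _
    positivity) 2
  refine ⟨convex_univ, ?_⟩
  rintro p hp p' hp' s t hs ht hst
  have h3 := h2.2 hp hp' hs ht hst
  simp only [Pi.add_apply, Pi.pow_apply, Pi.smul_apply, smul_eq_mul] at h3
  have h4 : (s • p + t • p').2 = s * p.2 + t * p'.2 := by simp
  simp only [Vfn, smul_eq_mul]
  generalize (r q * ‖(s • p + t • p').1‖ + Sfn d SigS μS γ (s • p + t • p').1 (s • p + t • p').2) ^ 2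
    = X at h3 ⊢
  rw [h4]
  have ht' : t = 1 - s := by linarith
  subst ht'
  linarith

theorem h_conv (d : ℕ) (SigN SigS : Matrix (Fin d) (Fin d) ℝ) (μN μS : E d) (γ : ℝ)
    (hPDS : SigS.PosDef) (r : ℝ → ℝ) (hrpos : ∀ q, 0 ≤ r q) (q lamM c : ℝ)
    (h : IsSmallestEigen (Mblock d SigN μN) lamM) (hq0 : 0 ≤ q) (hq1 : q ≤ 1)
    (hc : c ≤ (1 - q) * lamM) :
    ConvexOn ℝ Set.univ (fun p : E d × ℝ => hfn d SigN SigS μN μS γ r q p.1 p.2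
      - c * (‖p.1‖ ^ 2 + p.2 ^ 2)) := by
  have h1 : ConvexOn ℝ Set.univ (fun p : E d × ℝ => ‖p.1‖) :=
    (convexOn_norm convex_univ).comp_linearMap (LinearMap.fst ℝ (E d) ℝ)
  have h2 : ConvexOn ℝ Set.univ (fun p : E d × ℝ => |p.2|) :=
    (convexOn_norm convex_univ).comp_linearMap (LinearMap.snd ℝ (E d) ℝ)
  have h3 := (h1.pow (fun p _ => norm_nonneg _) 2).add (h2.pow (fun p _ => abs_nonneg _) 2)
  have h4 := (((eN_conv d SigN μN γ lamM h).smul (sub_nonneg.2 hq1)).add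
    ((V_conv d SigS μS γ hPDS r hrpos q).smul hq0)).add (h3.smul (sub_nonneg.2 hc))
  refine h4.congr ?_
  intro p _
  simp [hfn]
  ring

theorem h_bdd (d : ℕ) (SigN SigS : Matrix (Fin d) (Fin d) ℝ) (μN μS : E d) (γ : ℝ)
    (r : ℝ → ℝ) (hr : Continuous r) (u v : ℝ) (x : E d) (a : ℝ) :
    BddAbove ((fun q => hfn d SigN SigS μN μS γ r q x a) '' Set.Icc u v) := by
  refine (isCompact_Icc.image ?_).bddAbove
  unfold hfn Vfn
  fun_prop

theorem simplex_convex (d : ℕ) : Convex ℝ (simplexSet d) := by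
  rintro x ⟨hx, hx'⟩ y ⟨hy, hy'⟩ s t hs ht hst
  refine ⟨fun i => ?_, ?_⟩
  · have := hx i
    have := hy i
    simp only [PiLp.add_apply, PiLp.smul_apply, smul_eq_mul]
    positivity
  · simp [Finset.sum_add_distrib, ← Finset.mul_sum, hx', hy', hst]

theorem h_diff (d : ℕ) (SigN SigS : Matrix (Fin d) (Fin d) ℝ) (μN μS : E d) (γ : ℝ)
    (hPDS : SigS.PosDef) (r : ℝ → ℝ) (q : ℝ) (p : Pair d) (hp : p.fst ≠ 0) :
    DifferentiableAt ℝ (fun y : Pair d =>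
      hfn d SigN SigS μN μS γ r q (WithLp.equiv 2 (E d × ℝ) y).1
        (WithLp.equiv 2 (E d × ℝ) y).2) p := by
  have d1 : Differentiable ℝ (fun y : Pair d => y.fst) :=
    (WithLp.fstL 2 ℝ (E d) ℝ).differentiable
  have d2 : Differentiable ℝ (fun y : Pair d => y.snd) :=
    (WithLp.sndL 2 ℝ (E d) ℝ).differentiable
  have d3 : ∀ i, Differentiable ℝ (fun y : Pair d => y.fst i) := fun i =>
    ((EuclideanSpace.proj i : E d →L[ℝ] ℝ).differentiable).comp d1
  have d4 : DifferentiableAt ℝ (fun y : Pair d => ‖y.fst‖) p := (d1 p).norm ℝ hp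
  have dq : ∀ A : Matrix (Fin d) (Fin d) ℝ,
      Differentiable ℝ (fun y : Pair d => y.fst ⬝ᵥ A.mulVec y.fst) := by
    intro A
    simp only [dotProduct, mulVec]
    fun_prop
  have dl : ∀ m : E d, Differentiable ℝ (fun y : Pair d => y.fst ⬝ᵥ m) := by
    intro A
    simp only [dotProduct]
    fun_prop
  have hpos : 0 < p.fst ⬝ᵥ SigS.mulVec p.fst := by
    have := hPDS.dotProduct_mulVec_pos (x := p.fst.ofLp) (by simpa using hp)
    simpa using this
  have dS : DifferentiableAt ℝ (fun y : Pair d => Sfn d SigS μS γ y.fst y.snd) p := by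
    unfold Sfn
    have := dq SigS
    have := dl μS
    apply DifferentiableAt.sqrt
    · fun_prop
    · positivity
  have := dq SigN
  have := dl μN
  change DifferentiableAt ℝ (fun y : Pair d => hfn d SigN SigS μN μS γ r q y.fst y.snd) p
  unfold hfn eNfn Vfn
  fun_prop

theorem h_lip (d : ℕ) (SigN SigS : Matrix (Fin d) (Fin d) ℝ) (μN μS : E d) (γ : ℝ)
    (hPDS : SigS.PosDef) (r : ℝ → ℝ) (q : ℝ) (lo hi K₁ : ℝ)
    (hK₁ : ∀ x ∈ simplexSet d, ∀ a ∈ Set.Icc lo hi,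
      ‖gradh d SigN SigS μN μS γ r q (mkPair d x a)‖ ≤ K₁)
    (x : E d) (hx : x ∈ simplexSet d) (a : ℝ) (ha : a ∈ Set.Icc lo hi)
    (x' : E d) (hx' : x' ∈ simplexSet d) (a' : ℝ) (ha' : a' ∈ Set.Icc lo hi) :
    hfn d SigN SigS μN μS γ r q x a - hfn d SigN SigS μN μS γ r q x' a'
      ≤ K₁ * ‖mkPair d x a - mkPair d x' a'‖ := by
  have hc : Convex ℝ ({p : Pair d | p.fst ∈ simplexSet d ∧ p.snd ∈ Set.Icc lo hi}) :=
    Convex.inter ((simplex_convex d).is_linear_preimage (WithLp.fstL 2 ℝ (E d) ℝ).isBoundedLinearMap.toIsLinearMap)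
      ((convex_Icc lo hi).is_linear_preimage (WithLp.sndL 2 ℝ (E d) ℝ).isBoundedLinearMap.toIsLinearMap)
  have := hc.norm_image_sub_le_of_norm_fderiv_le (𝕜 := ℝ) (C := K₁)
    (f := fun y : Pair d => hfn d SigN SigS μN μS γ r q (WithLp.equiv 2 (E d × ℝ) y).1
        (WithLp.equiv 2 (E d × ℝ) y).2) (x := mkPair d x' a') (y := mkPair d x a)
    (fun p hp => h_diff d SigN SigS μN μS γ hPDS r q p (by
      intro h0
      have := hp.1.2
      simp [h0] at this))
    (fun p hp => by
      have := hK₁ _ hp.1 _ hp.2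
      rw [gradh, gradient, LinearIsometryEquiv.norm_map] at this
      exact this) ⟨hx', ha'⟩ ⟨hx, ha⟩
  exact (le_abs_self _).trans this

/-- if `‖∇_{(x,a)}h(q,x,a)‖ ≤ K₁` on `Ω`, then `J` is `K₁`-Lipschitz on `Δ × I`
(with respect to the Euclidean norm on pairs) and `((1−q₀−ε)λ_M)`-strongly convex on
`Δ × I`. -/
theorem stmt6 (d : ℕ) (hd : 1 ≤ d)
    (γ : ℝ) (hγ : 0 < γ) (μN μS : E d) (SigN SigS : Matrix (Fin d) (Fin d) ℝ)
    (hSymN : SigN.IsSymm) (hPDN : SigN.PosDef) (hSymS : SigS.IsSymm) (hPDS : SigS.PosDef)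
    (r : ℝ → ℝ) (hr : ContDiff ℝ 2 r) (hrpos : ∀ q, 0 ≤ r q)
    (q₀ ε : ℝ) (hε : 0 ≤ ε) (hq1 : 0 < q₀ - ε) (hq2 : q₀ + ε < 1)
    (lo hi : ℝ) (hIo : lo ≤ hi)
    (lamM : ℝ) (hlamM : IsSmallestEigen (Mblock d SigN μN) lamM) (hlamMpos : 0 < lamM)
    (K₁ : ℝ)
    (hK₁ : ∀ q ∈ Set.Icc (q₀ - ε) (q₀ + ε), ∀ x ∈ simplexSet d, ∀ a ∈ Set.Icc lo hi,
      ‖gradh d SigN SigS μN μS γ r q (mkPair d x a)‖ ≤ K₁) :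
    (∀ x ∈ simplexSet d, ∀ a ∈ Set.Icc lo hi, ∀ x' ∈ simplexSet d, ∀ a' ∈ Set.Icc lo hi,
        |Jfn d SigN SigS μN μS γ r q₀ ε x a - Jfn d SigN SigS μN μS γ r q₀ ε x' a'|
          ≤ K₁ * ‖mkPair d x a - mkPair d x' a'‖)
      ∧ ConvexOn ℝ (simplexSet d ×ˢ Set.Icc lo hi)
          (fun pt : E d × ℝ => Jfn d SigN SigS μN μS γ r q₀ ε pt.1 pt.2
            - (1 - q₀ - ε) * lamM / 2 * (‖pt.1‖ ^ 2 + pt.2 ^ 2)) := by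
  have hne : (Set.Icc (q₀ - ε) (q₀ + ε)).Nonempty := ⟨q₀, by constructor <;> linarith⟩
  have hle : ∀ q ∈ Set.Icc (q₀ - ε) (q₀ + ε), ∀ x a,
      hfn d SigN SigS μN μS γ r q x a ≤ Jfn d SigN SigS μN μS γ r q₀ ε x a := fun q hq x a =>
    le_csSup (h_bdd d SigN SigS μN μS γ r hr.continuous _ _ x a) ⟨q, hq, rfl⟩
  have hge : ∀ x a B, (∀ q ∈ Set.Icc (q₀ - ε) (q₀ + ε), hfn d SigN SigS μN μS γ r q x a ≤ B) →
      Jfn d SigN SigS μN μS γ r q₀ ε x a ≤ B := by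
    intro x a B hB
    refine csSup_le (hne.image _) ?_
    rintro _ ⟨q, hq, rfl⟩
    exact hB q hq
  have hlip : ∀ x ∈ simplexSet d, ∀ a ∈ Set.Icc lo hi, ∀ x' ∈ simplexSet d, ∀ a' ∈ Set.Icc lo hi,
        Jfn d SigN SigS μN μS γ r q₀ ε x a - Jfn d SigN SigS μN μS γ r q₀ ε x' a'
          ≤ K₁ * ‖mkPair d x a - mkPair d x' a'‖ := by
    intro x hx a ha x' hx' a' ha'
    rw [sub_le_iff_le_add]
    refine hge _ _ _ fun q hq => ?_
    have h1 := h_lip d SigN SigS μN μS γ hPDS r q lo hi K₁ (hK₁ q hq) x hx a ha x' hx' a' ha'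
    have h2 := hle q hq x' a'
    linarith
  refine ⟨fun x hx a ha x' hx' a' ha' => abs_sub_le_iff.2 ⟨hlip x hx a ha x' hx' a' ha', ?_⟩, ?_⟩
  · rw [norm_sub_rev]
    exact hlip x' hx' a' ha' x hx a ha
  · refine ⟨(simplex_convex d).prod (convex_Icc lo hi), ?_⟩
    intro p _ p' _ s t hs ht hst
    rw [sub_le_iff_le_add]
    refine hge _ _ _ fun q hq => ?_
    have h1 := (h_conv d SigN SigS μN μS γ hPDS r hrpos q lamM ((1 - q₀ - ε) * lamM / 2) hlamM
      (by linarith [hq.1]) (by linarith [hq.2]) (by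
        have : (1 - q₀ - ε) * lamM ≤ (1 - q) * lamM :=
          mul_le_mul_of_nonneg_right (by linarith [hq.2]) hlamMpos.le
        have : 0 ≤ (1 - q₀ - ε) * lamM := mul_nonneg (by linarith) hlamMpos.le
        linarith)).2 (Set.mem_univ p) (Set.mem_univ p') hs ht hst
    have h2 := mul_le_mul_of_nonneg_left (hle q hq p.1 p.2) hs
    have h3 := mul_le_mul_of_nonneg_left (hle q hq p'.1 p'.2) ht
    simp only [smul_eq_mul] at h1 ⊢
    linarith
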